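/- arXiv:0907.0845 — 4 statements merged into one kernel-verified Lean document; each statement's English description precedes it below -/
import Mathlib

section
/- Let G = (V,E) be an oriented graph, T ⊆ E a spanning forest of G with complement T^c = E \ T, and let C ∈ {0,±1}^{T^c × E} be the fundamental cycle matrix of T: the row of f ∈ T^c is supported on the unique undirected cycle in G[T ∪ {f}], with signs +1 on edges oriented consistently with the traversal of that cycle that traverses f forward and −1 on the remaining edges of the cycle. Then for every positive integer k, the number of nowhere-zero Z_k-flows of G equals the number of integer vectors h ∈ Z^{T^c} with 0 < h_f < k for every f ∈ T^c and with (h^T C)_e not divisible by k for every e ∈ T. -/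
namespace ModularFlows

attribute [local instance] Classical.propDecidable

variable {V E : Type}

/-- A directed (simple) cycle, given by its cyclically ordered edges
`c 0, c 1, …, c n`: consecutive edges are head-to-tail compatible (also from
`c n` back to `c 0`) and the start vertices are pairwise distinct. -/
def IsDirCycle (src tgt : E → V) (n : ℕ) (c : Fin (n + 1) → E) : Prop :=
  Function.Injective (fun i => src (c i)) ∧ ∀ i, tgt (c i) = src (c (i + 1))

/-- An oriented graph is totally cyclic if every edge lies on a directed cycle. -/
def TotallyCyclic (src tgt : E → V) : Prop :=
  ∀ e : E, ∃ (n : ℕ) (c : Fin (n + 1) → E), IsDirCycle src tgt n c ∧ e ∈ Set.range c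

/-- An oriented graph is acyclic if it contains no directed cycle. -/
def Acyclic (src tgt : E → V) : Prop :=
  ∀ (n : ℕ) (c : Fin (n + 1) → E), ¬ IsDirCycle src tgt n c

/-- Source map of the reorientation of the graph along `σ`. -/
noncomputable def rsrc (src tgt : E → V) (σ : Set E) (e : E) : V :=
  if e ∈ σ then tgt e else src e

/-- Target map of the reorientation of the graph along `σ`. -/
noncomputable def rtgt (src tgt : E → V) (σ : Set E) (e : E) : V :=
  if e ∈ σ then src e else tgt e

/-- A `ZMod k`-flow: conservation of flow at every vertex. -/
def IsFlow [Fintype E] (src tgt : E → V) (k : ℕ) (f : E → ZMod k) : Prop :=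
  ∀ v : V, (∑ e : E, if tgt e = v then f e else 0) = ∑ e : E, if src e = v then f e else 0

/-- Start vertex of an edge traversed forwards (`true`) or backwards (`false`). -/
def uSrc (src tgt : E → V) (p : E × Bool) : V := if p.2 then src p.1 else tgt p.1

/-- End vertex of an edge traversed forwards (`true`) or backwards (`false`). -/
def uTgt (src tgt : E → V) (p : E × Bool) : V := if p.2 then tgt p.1 else src p.1

/-- A cycle of the underlying undirected graph, with a chosen traversal
direction: a cyclic sequence of edges, each traversed forwards or backwards,
consecutive ones compatible, visiting pairwise distinct vertices. -/
def IsUCycle (src tgt : E → V) (n : ℕ) (c : Fin (n + 1) → E × Bool) : Prop :=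
  Function.Injective (fun i => uSrc src tgt (c i)) ∧
    ∀ i, uTgt src tgt (c i) = uSrc src tgt (c (i + 1))

/-- A `ZMod l`-tension: the signed sum over every cycle of the underlying
undirected graph (forward edges positively, backward edges negatively) vanishes. -/
def IsTension (src tgt : E → V) (l : ℕ) (t : E → ZMod l) : Prop :=
  ∀ (n : ℕ) (c : Fin (n + 1) → E × Bool), IsUCycle src tgt n c →
    (∑ i : Fin (n + 1), if (c i).2 then t (c i).1 else - t (c i).1) = 0

/-- Adjacency via an edge of `S` (its equivalence closure gives the components
of the spanning subgraph `(V, S)`). -/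
def linkRel (src tgt : E → V) (S : Set E) (u v : V) : Prop :=
  ∃ e ∈ S, src e = u ∧ tgt e = v

/-- Number of (weakly) connected components of the spanning subgraph `(V, S)`. -/
noncomputable def ncompSub (src tgt : E → V) (S : Set E) : ℕ :=
  Nat.card (Quot (linkRel src tgt S))

/-- Number of (weakly) connected components. -/
noncomputable def ncomp (src tgt : E → V) : ℕ :=
  ncompSub src tgt Set.univ

/-- The cyclotomic number `ξ(G) = |E| - |V| + c(G)`. -/
noncomputable def xi [Fintype V] [Fintype E] (src tgt : E → V) : ℤ :=
  (Fintype.card E : ℤ) - (Fintype.card V : ℤ) + (ncomp src tgt : ℤ)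

/-- Source map of the contraction `G/S`: vertices are identified along edges of
`S`, and the edges of `S` are removed. -/
def csrc (src tgt : E → V) (S : Set E) (e : {e : E // e ∉ S}) :
    Quot (linkRel src tgt S) :=
  Quot.mk _ (src e.1)

/-- Target map of the contraction `G/S`. -/
def ctgt (src tgt : E → V) (S : Set E) (e : {e : E // e ∉ S}) :
    Quot (linkRel src tgt S) :=
  Quot.mk _ (tgt e.1)

/-- Source (or target) map of the deletion `G∖S`. -/
def dsrc (src : E → V) (S : Set E) (e : {e : E // e ∉ S}) : V := src e.1

/-- Source (or target) map of the restriction `G[S]`. -/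
def ressrc (src : E → V) (S : Set E) (e : {e : E // e ∈ S}) : V := src e.1

/-- `σ` is a totally cyclic reorientation of the contraction `G/S`. -/
def TCReorContr (src tgt : E → V) (S σ : Set E) : Prop :=
  TotallyCyclic (rsrc (csrc src tgt S) (ctgt src tgt S) {e | e.1 ∈ σ})
                (rtgt (csrc src tgt S) (ctgt src tgt S) {e | e.1 ∈ σ})

/-- `σ` is a totally cyclic reorientation of the deletion `G∖S`. -/
def TCReorDel (src tgt : E → V) (S σ : Set E) : Prop :=
  TotallyCyclic (rsrc (dsrc src S) (dsrc tgt S) {e | e.1 ∈ σ})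
                (rtgt (dsrc src S) (dsrc tgt S) {e | e.1 ∈ σ})

/-- `σ` is an acyclic reorientation of the deletion `G∖S`. -/
def AcyclicReorDel (src tgt : E → V) (S σ : Set E) : Prop :=
  Acyclic (rsrc (dsrc src S) (dsrc tgt S) {e | e.1 ∈ σ})
          (rtgt (dsrc src S) (dsrc tgt S) {e | e.1 ∈ σ})

/-- Entry of the incidence matrix `A_G` at vertex `v` and edge `e`. -/
noncomputable def inc (src tgt : E → V) (v : V) (e : E) : ℤ :=
  (if tgt e = v then 1 else 0) - (if src e = v then 1 else 0)

/-- The number of nowhere-zero `ZMod k`-flows. -/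
noncomputable def nzFlowCount [Fintype E] (src tgt : E → V) (k : ℕ) : ℕ :=
  Nat.card {f : E → ZMod k // IsFlow src tgt k f ∧ ∀ e, f e ≠ 0}

/-- The number of nowhere-zero `ZMod l`-tensions. -/
noncomputable def nzTensionCount (src tgt : E → V) (l : ℕ) : ℕ :=
  Nat.card {t : E → ZMod l // IsTension src tgt l t ∧ ∀ e, t e ≠ 0}

/-- The rank `r(S) = |V| - c(V,S)` of an edge set `S`. -/
noncomputable def rk [Fintype V] (src tgt : E → V) (S : Set E) : ℕ :=
  Fintype.card V - ncompSub src tgt S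

/-- The Tutte polynomial `t_G(x,y) = Σ_{S ⊆ E} (x-1)^{r(E)-r(S)} (y-1)^{|S|-r(S)}`. -/
noncomputable def tutte [Fintype V] [Fintype E] (src tgt : E → V) (x y : ℚ) : ℚ :=
  ∑ S : Finset E,
    (x - 1) ^ (rk src tgt Set.univ - rk src tgt ↑S) * (y - 1) ^ (S.card - rk src tgt ↑S)

/-- `e` is a coloop (bridge): deleting it increases the number of components. -/
def IsColoop (src tgt : E → V) (e : E) : Prop :=
  ncompSub src tgt ({e} : Set E)ᶜ = ncomp src tgt + 1

/-- The number of pairs `(f, σ)` of a `ZMod k`-flow `f` and a totally cyclic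
reorientation `σ ⊆ E ∖ supp f` of the contraction `G/supp f`. -/
noncomputable def phiR [Fintype E] (src tgt : E → V) (k : ℕ) : ℕ :=
  Nat.card {p : (E → ZMod k) × Set E //
    IsFlow src tgt k p.1 ∧ p.2 ⊆ {e | p.1 e = 0} ∧
    TCReorContr src tgt {e | p.1 e ≠ 0} p.2}

/-- The in-degree sequence of the reorientation of the graph along `σ`. -/
noncomputable def indegSeq [Fintype E] (src tgt : E → V) (σ : Set E) (v : V) : ℤ :=
  (Nat.card {e : E // rtgt src tgt σ e = v} : ℤ)

/-- The vector `A_G · e_σ`, where `e_σ` is the characteristic vector of `σ`. -/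
noncomputable def AeVec [Fintype E] (src tgt : E → V) (σ : Set E) (v : V) : ℤ :=
  ∑ e : E, if e ∈ σ then inc src tgt v e else 0

/-- `τ'` is obtained from `τ` by reversing a directed cycle of `_τG`. -/
def cycleReverse (src tgt : E → V) (τ τ' : Set E) : Prop :=
  ∃ (n : ℕ) (c : Fin (n + 1) → E),
    IsDirCycle (rsrc src tgt τ) (rtgt src tgt τ) n c ∧ τ' = symmDiff τ (Set.range c)


/-- The coboundary map restricted to the edge set `T`, sending a potential `g` on the vertices
to the differences `g (tgt e) - g (src e)`. -/
def coboundary (src tgt : E → V) (T : Set E) (A : Type) [AddCommGroup A] :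
    (V → A) →+ (T → A) where
  toFun g e := g (tgt e) - g (src e)
  map_zero' := by ext; simp
  map_add' g h := by ext; simp only [Pi.add_apply]; abel

theorem card_coboundary_ker_le [Finite V] (src tgt : E → V) (T : Set E) (k : ℕ) [NeZero k] :
    Nat.card (coboundary src tgt T (ZMod k)).ker ≤ k ^ ncompSub src tgt T := by
  have hc : Nat.card (Quot (linkRel src tgt T) → ZMod k) = k ^ ncompSub src tgt T := by
    rw [Nat.card_fun, Nat.card_zmod, ncompSub]
  rw [← hc]
  have hg (g : (coboundary src tgt T (ZMod k)).ker) (u v : V) (h : linkRel src tgt T u v) :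
      g.1 u = g.1 v := by
    obtain ⟨e, he, rfl, rfl⟩ := h
    exact (sub_eq_zero.mp (congrFun (AddMonoidHom.mem_ker.mp g.2) ⟨e, he⟩)).symm
  refine Nat.card_le_card_of_injective (fun g => Quot.lift g.1 (hg g)) fun g h hgh => ?_
  ext v
  exact congrFun hgh (Quot.mk _ v)

/-- Every edge labelling of a forest is the difference of a vertex potential. -/
theorem coboundary_surjective [Finite V] [Finite E] (src tgt : E → V) (T : Set E)
    (hT : T.ncard + ncompSub src tgt T = Nat.card V) (k : ℕ) [NeZero k] :
    Function.Surjective (coboundary src tgt T (ZMod k)) := by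
  rw [← AddMonoidHom.range_eq_top]
  apply AddSubgroup.eq_top_of_le_card
  rw [Nat.card_fun, Nat.card_zmod, Nat.card_coe_set_eq]
  have h := (coboundary src tgt T (ZMod k)).ker.card_mul_index
  rw [AddSubgroup.index_ker, Nat.card_fun, Nat.card_zmod, ← hT, add_comm, pow_add] at h
  have hk : 0 < k ^ ncompSub src tgt T := pow_pos (NeZero.pos k) _
  refine Nat.le_of_mul_le_mul_left ?_ hk
  rw [← h]
  exact Nat.mul_le_mul_right _ (card_coboundary_ker_le src tgt T k)

theorem isFlow_iff_sum_inc [Fintype E] (src tgt : E → V) (k : ℕ) (f : E → ZMod k) :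
    IsFlow src tgt k f ↔ ∀ v, ∑ e, (inc src tgt v e : ZMod k) * f e = 0 := by
  refine forall_congr' fun v => ?_
  rw [← sub_eq_zero, ← Finset.sum_sub_distrib]
  simp [inc, sub_mul]

/-- Flows are orthogonal to differences of vertex potentials. -/
theorem IsFlow.sum_mul_sub_eq_zero [Fintype V] [Fintype E] {src tgt : E → V} {k : ℕ}
    {f : E → ZMod k} (hf : IsFlow src tgt k f) (g : V → ZMod k) :
    ∑ e, f e * (g (tgt e) - g (src e)) = 0 := by
  have h (e : E) : f e * (g (tgt e) - g (src e)) =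
      ∑ v, g v * ((inc src tgt v e : ZMod k) * f e) := by
    simp [inc, mul_sub, Finset.sum_sub_distrib, mul_comm]
  simp_rw [h]
  rw [Finset.sum_comm]
  simp_rw [← Finset.mul_sum, (isFlow_iff_sum_inc src tgt k f).mp hf, mul_zero,
    Finset.sum_const_zero]

/-- A flow supported on a forest vanishes. -/
theorem IsFlow.eq_zero_of_support_subset [Fintype V] [Fintype E] {src tgt : E → V} {T : Set E}
    (hT : T.ncard + ncompSub src tgt T = Nat.card V) {k : ℕ} [NeZero k] {f : E → ZMod k}
    (hf : IsFlow src tgt k f) (hfT : ∀ e ∉ T, f e = 0) : f = 0 := by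
  funext e
  by_cases he : e ∈ T
  · obtain ⟨g, hg⟩ := coboundary_surjective src tgt T hT k (Pi.single ⟨e, he⟩ 1)
    have h := hf.sum_mul_sub_eq_zero g
    rw [Finset.sum_eq_single e] at h
    · have hge : g (tgt e) - g (src e) = 1 := by simpa [coboundary] using congrFun hg ⟨e, he⟩
      simpa [hge] using h
    · intro e' _ hne
      by_cases he' : e' ∈ T
      · have hge : g (tgt e') - g (src e') = 0 := by
          simpa [coboundary, Pi.single_apply, hne] using congrFun hg ⟨e', he'⟩
        rw [hge, mul_zero]
      · rw [hfT e' he', zero_mul]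
    · simp
  · exact hfT e he

/-- Integer combinations of integer flows reduce to `ZMod k`-flows. -/
theorem isFlow_intCast_sum_mul [Fintype E] {ι : Type} [Fintype ι] (src tgt : E → V) (k : ℕ)
    (C : ι → E → ℤ) (hC : ∀ i v, ∑ e, inc src tgt v e * C i e = 0) (h : ι → ℤ) :
    IsFlow src tgt k fun e => ((∑ i, h i * C i e : ℤ) : ZMod k) := by
  rw [isFlow_iff_sum_inc]
  intro v
  have hz : ∑ e, inc src tgt v e * ∑ i, h i * C i e = 0 := by
    simp_rw [Finset.mul_sum, mul_left_comm]
    rw [Finset.sum_comm]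
    simp_rw [← Finset.mul_sum, hC, mul_zero, Finset.sum_const_zero]
  exact_mod_cast congrArg (Int.cast : ℤ → ZMod k) hz

theorem IsFlow.sub [Fintype E] {src tgt : E → V} {k : ℕ} {f g : E → ZMod k}
    (hf : IsFlow src tgt k f) (hg : IsFlow src tgt k g) : IsFlow src tgt k (f - g) := by
  rw [isFlow_iff_sum_inc] at *
  intro v
  simp [mul_sub, Finset.sum_sub_distrib, hf v, hg v]

/-- Inside-out description of nowhere-zero flows: given a spanning forest `T`
and the fundamental cycle matrix `C` of `T` (each row of `C` is the unique
`{0,±1}`-vector in the kernel of the incidence matrix that is supported on the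
unique undirected cycle of `G[T ∪ {f}]` and takes value `1` on `f`), the number
of nowhere-zero `ZMod k`-flows equals the number of integer vectors
`h ∈ ℤ^{T^c}` with `0 < h_f < k` for all `f ∈ T^c` and `(h^T C)_e` not
divisible by `k` for all `e ∈ T`. -/
theorem flows_via_fundamental_cycles {V E : Type} [Fintype V] [Fintype E]
    (src tgt : E → V) (T : Set E)
    (hT1 : ncompSub src tgt T = ncomp src tgt)
    (hT2 : (T.ncard : ℤ) = (Fintype.card V : ℤ) - ncomp src tgt)
    (k : ℕ) (hk : 0 < k)
    (C : {e : E // e ∉ T} → E → ℤ)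
    (hC : ∀ f : {e : E // e ∉ T},
      (∀ v : V, (∑ e : E, inc src tgt v e * C f e) = 0) ∧
      (∀ e : E, e ∉ T → e ≠ f.1 → C f e = 0) ∧
      C f f.1 = 1 ∧
      (∀ e : E, C f e = -1 ∨ C f e = 0 ∨ C f e = 1)) :
    nzFlowCount src tgt k =
      Nat.card {h : {e : E // e ∉ T} → ℤ //
        (∀ f, 0 < h f ∧ h f < k) ∧
        ∀ e : E, e ∈ T →
          ¬ ((k : ℤ) ∣ ∑ f : {e : E // e ∉ T}, h f * C f e)} := by
  have : NeZero k := ⟨hk.ne'⟩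
  have hT : T.ncard + ncompSub src tgt T = Nat.card V := by
    rw [Nat.card_eq_fintype_card]
    omega
  have hval (h : {e : E // e ∉ T} → ℤ) (f : {e : E // e ∉ T}) :
      ∑ i, h i * C i f.1 = h f := by
    rw [Finset.sum_eq_single f]
    · rw [(hC f).2.2.1, mul_one]
    · intro i _ hi
      rw [(hC i).2.1 f.1 f.2 fun hfi => hi (Subtype.ext hfi.symm), mul_zero]
    · simp
  have hflow (h : {e : E // e ∉ T} → ℤ) :=
    isFlow_intCast_sum_mul src tgt k C (fun i => (hC i).1) h
  symm
  refine Nat.card_eq_of_bijective (fun h => ⟨fun e => ((∑ i, h.1 i * C i e : ℤ) : ZMod k),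
    hflow h.1, fun e => ?_⟩) ⟨fun h h' heq => ?_, fun F => ?_⟩
  · rw [Ne, ZMod.intCast_zmod_eq_zero_iff_dvd]
    by_cases he : e ∈ T
    · exact h.2.2 e he
    · have hb := h.2.1 ⟨e, he⟩
      rw [hval h.1 ⟨e, he⟩]
      exact fun hd => absurd (Int.le_of_dvd hb.1 hd) (not_le.mpr hb.2)
  · ext f
    have hf := congrFun (congrArg Subtype.val heq) f.1
    simp only [hval] at hf
    have hm := (ZMod.intCast_eq_intCast_iff _ _ _).mp hf
    have hb := h.2.1 f
    have hb' := h'.2.1 f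
    rwa [Int.ModEq, Int.emod_eq_of_lt hb.1.le hb.2, Int.emod_eq_of_lt hb'.1.le hb'.2] at hm
  · obtain ⟨F, hF, hF0⟩ := F
    let h : {e : E // e ∉ T} → ℤ := fun f => ((F f.1).val : ℤ)
    have hFh : (fun e => ((∑ i, h i * C i e : ℤ) : ZMod k)) = F := by
      refine sub_eq_zero.mp (((hflow h).sub hF).eq_zero_of_support_subset hT fun e he => ?_)
      simp only [Pi.sub_apply]
      rw [hval h ⟨e, he⟩]
      simp [h]
    refine ⟨⟨h, fun f => ⟨?_, ?_⟩, fun e _ => ?_⟩, Subtype.ext hFh⟩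
    · exact Int.natCast_pos.mpr <| Nat.pos_of_ne_zero ((ZMod.val_ne_zero _).mpr (hF0 f.1))
    · exact Int.ofNat_lt.mpr (ZMod.val_lt _)
    · rw [← ZMod.intCast_zmod_eq_zero_iff_dvd]
      exact fun h0 => hF0 e ((congrFun hFh e).symm.trans h0)

end ModularFlows
end

section
/- Let G = (V,E) be an oriented graph and ℓ a positive integer. Then the number of proper ℓ-colorings of G equals ℓ^{c(G)} times the number of nowhere-zero Z_ℓ-tensions of G; that is, χ_G(ℓ) = ℓ^{c(G)} · τ̄_G(ℓ). -/
namespace ModularFlows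

attribute [local instance] Classical.propDecidable

variable {V E : Type}

/-- A list of traversed edges is a walk from `u` to `v`. -/
def IsWalk (src tgt : E → V) : V → List (E × Bool) → V → Prop
  | u, [], v => u = v
  | u, a :: L, v => uSrc src tgt a = u ∧ IsWalk src tgt (uTgt src tgt a) L v

/-- The value of `t` on a traversed edge, negated on backward traversal. -/
def signedVal {A : Type*} [Neg A] (t : E → A) (a : E × Bool) : A :=
  if a.2 then t a.1 else -t a.1

/-- The signed sum of `t` along a list of traversed edges. -/
def walkSum {l : ℕ} (t : E → ZMod l) (L : List (E × Bool)) : ZMod l :=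
  (L.map (signedVal t)).sum

theorem walkSum_append {l : ℕ} (t : E → ZMod l) (L M : List (E × Bool)) :
    walkSum t (L ++ M) = walkSum t L + walkSum t M := by
  simp [walkSum]

theorem isWalk_append {src tgt : E → V} {u v : V} {L M : List (E × Bool)} :
    IsWalk src tgt u (L ++ M) v ↔ ∃ w, IsWalk src tgt u L w ∧ IsWalk src tgt w M v := by
  induction L generalizing u with
  | nil => simp [IsWalk]
  | cons a L ih => simp [IsWalk, ih, and_assoc]

theorem IsWalk.uSrc_head {src tgt : E → V} {u v : V} {L : List (E × Bool)}
    (h : IsWalk src tgt u L v) (h0 : 0 < L.length) : uSrc src tgt L[0] = u := by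
  cases L with
  | nil => simp at h0
  | cons a L => exact h.1

theorem IsWalk.uTgt_getElem {src tgt : E → V} {u v : V} {L : List (E × Bool)}
    (h : IsWalk src tgt u L v) {i : ℕ} (hi : i < L.length) :
    uTgt src tgt L[i] = if h' : i + 1 < L.length then uSrc src tgt L[i + 1] else v := by
  induction L generalizing u i with
  | nil => simp at hi
  | cons a L ih =>
    cases i with
    | zero =>
      cases L with
      | nil => simpa [IsWalk] using h.2
      | cons b L => simpa using h.2.1.symm
    | succ i =>
      have := ih h.2 (i := i) (by simpa using hi)
      simpa using this

/-- The signed sum of a tension over any closed walk vanishes. -/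
theorem IsTension.walkSum_eq_zero {src tgt : E → V} {l : ℕ} {t : E → ZMod l}
    (ht : IsTension src tgt l t) {u : V} {L : List (E × Bool)}
    (hL : IsWalk src tgt u L u) : walkSum t L = 0 := by
  induction hn : L.length using Nat.strong_induction_on generalizing u L with
  | _ n ih =>
  subst hn
  by_cases hinj : Function.Injective fun i : Fin L.length => uSrc src tgt L[i]
  · rcases Nat.eq_zero_or_eq_succ_pred L.length with h0 | h0
    · simp [walkSum, List.length_eq_zero_iff.mp h0]
    obtain ⟨n, hn⟩ : ∃ n, L.length = n + 1 := ⟨_, h0⟩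
    have key := ht n (fun i => L[i.val]'(by omega)) ⟨?_, ?_⟩
    · rw [walkSum, ← Fin.sum_univ_getElem, ← key]
      exact Fintype.sum_equiv (finCongr (by simp [hn])) _ _ fun i => by simp [signedVal]
    · intro i j hij
      have := @hinj ⟨i, by omega⟩ ⟨j, by omega⟩ hij
      exact Fin.ext (by simpa using this)
    · intro i
      rw [hL.uTgt_getElem]
      split_ifs with h
      · congr 2
        rw [Fin.val_add_one_of_lt (by rw [Fin.lt_def, Fin.val_last]; omega)]
      · obtain rfl : i = Fin.last n := Fin.ext (by rw [Fin.val_last]; omega)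
        simpa using (hL.uSrc_head (by omega)).symm
  · obtain ⟨i, j, hij, hlt⟩ : ∃ i j : Fin L.length,
        uSrc src tgt L[i] = uSrc src tgt L[j] ∧ i < j := by
      simp only [Function.Injective, not_forall] at hinj
      obtain ⟨i, j, h, hne⟩ := hinj
      rcases lt_or_gt_of_ne hne with hlt | hlt
      · exact ⟨i, j, h, hlt⟩
      · exact ⟨j, i, h.symm, hlt⟩
    have hlt' : i.val < j.val := hlt
    have hj := j.isLt
    have hdec : L = L.take i ++ ((L.drop i).take (j - i) ++ L.drop j) := by
      conv_lhs => rw [← List.take_append_drop i L, ← List.take_append_drop (j - i) (L.drop i)]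
      rw [List.drop_drop, Nat.add_sub_cancel' hlt'.le]
    have hL' := hL
    rw [hdec, isWalk_append] at hL'
    obtain ⟨w, hA, hBC⟩ := hL'
    obtain ⟨x, hB, hC⟩ := isWalk_append.mp hBC
    have hw := hB.uSrc_head (by simp; omega)
    have hx := hC.uSrc_head (by simp)
    simp only [List.getElem_take, List.getElem_drop, Nat.add_zero] at hw hx
    obtain rfl : w = x := by rw [← hw, ← hx]; exact hij
    have hmid := ih _ (by simp; omega) hB rfl
    have hrest := ih _ (by simp; omega) (isWalk_append.mpr ⟨w, hA, hC⟩) rfl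
    rw [walkSum_append] at hrest
    rw [hdec, walkSum_append, walkSum_append, hmid, zero_add, hrest]

theorem exists_isWalk_of_eqvGen {src tgt : E → V} {u v : V}
    (h : Relation.EqvGen (linkRel src tgt Set.univ) u v) :
    (∃ L, IsWalk src tgt u L v) ∧ ∃ L, IsWalk src tgt v L u := by
  induction h with
  | rel u v h =>
    obtain ⟨e, -, rfl, rfl⟩ := h
    exact ⟨⟨[(e, true)], by simp [IsWalk, uSrc, uTgt]⟩,
      ⟨[(e, false)], by simp [IsWalk, uSrc, uTgt]⟩⟩
  | refl u => exact ⟨⟨[], rfl⟩, ⟨[], rfl⟩⟩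
  | symm u v _ ih => exact ih.symm
  | trans u v w _ _ ih₁ ih₂ =>
    obtain ⟨⟨A, hA⟩, ⟨A', hA'⟩⟩ := ih₁
    obtain ⟨⟨B, hB⟩, ⟨B', hB'⟩⟩ := ih₂
    exact ⟨⟨A ++ B, isWalk_append.mpr ⟨_, hA, hB⟩⟩, ⟨B' ++ A', isWalk_append.mpr ⟨_, hB', hA'⟩⟩⟩

/-- The component of a vertex. -/
def component (src tgt : E → V) (v : V) : Quot (linkRel src tgt Set.univ) :=
  Quot.mk _ v

theorem component_src (src tgt : E → V) (e : E) :
    component src tgt (src e) = component src tgt (tgt e) :=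
  Quot.sound ⟨e, trivial, rfl, rfl⟩

/-- Every tension is the difference of a potential. -/
theorem IsTension.exists_potential {src tgt : E → V} {l : ℕ} {t : E → ZMod l}
    (ht : IsTension src tgt l t) : ∃ p : V → ZMod l, ∀ e, t e = p (tgt e) - p (src e) := by
  have hroot (v : V) : (∃ L, IsWalk src tgt v L (component src tgt v).out) ∧
      ∃ L, IsWalk src tgt (component src tgt v).out L v :=
    exists_isWalk_of_eqvGen (Quot.eqvGen_exact (Quot.out_eq (component src tgt v)).symm)
  choose W hW using fun v => (hroot v).2
  refine ⟨fun v => walkSum t (W v), fun e => ?_⟩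
  obtain ⟨L, hL⟩ := (hroot (tgt e)).1
  have hsrc := hW (src e)
  rw [component_src src tgt e] at hsrc
  have h₁ := ht.walkSum_eq_zero (isWalk_append.mpr ⟨_, hW (tgt e), hL⟩)
  have h₂ := ht.walkSum_eq_zero (isWalk_append.mpr
    ⟨_, hsrc, (show IsWalk src tgt (src e) ((e, true) :: L) _ from ⟨by simp [uSrc], hL⟩)⟩)
  rw [walkSum_append] at h₁ h₂
  have h₃ : walkSum t ((e, true) :: L) = t e + walkSum t L := by simp [walkSum, signedVal]
  rw [h₃] at h₂
  linear_combination h₂ - h₁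

/-- The difference of a potential is a tension. -/
theorem isTension_sub (src tgt : E → V) {l : ℕ} (p : V → ZMod l) :
    IsTension src tgt l fun e => p (tgt e) - p (src e) := by
  intro n c hc
  have h (i : Fin (n + 1)) :
      (if (c i).2 then p (tgt (c i).1) - p (src (c i).1)
        else -(p (tgt (c i).1) - p (src (c i).1))) =
        p (uSrc src tgt (c (i + 1))) - p (uSrc src tgt (c i)) := by
    rw [← hc.2 i]
    unfold uSrc uTgt
    split_ifs <;> simp
  simp only [h]
  rw [Finset.sum_sub_distrib, sub_eq_zero]
  exact Equiv.sum_comp (Equiv.addRight (1 : Fin (n + 1))) fun i => p (uSrc src tgt (c i))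

theorem eq_of_component_eq {A : Type*} {src tgt : E → V} {p : V → A}
    (hp : ∀ e, p (src e) = p (tgt e)) {u v : V}
    (h : component src tgt u = component src tgt v) : p u = p v :=
  congrArg (Quot.lift p (by rintro _ _ ⟨e, -, rfl, rfl⟩; exact hp e)) h

/-- A proper colouring corresponds to its values at chosen component representatives
together with its difference tension. -/
noncomputable def coloringEquiv (src tgt : E → V) (l : ℕ) :
    {c : V → ZMod l // ∀ e : E, c (src e) ≠ c (tgt e)} ≃
      (Quot (linkRel src tgt Set.univ) → ZMod l) ×
        {t : E → ZMod l // IsTension src tgt l t ∧ ∀ e, t e ≠ 0} := by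
  refine Equiv.ofBijective (fun c => (fun q => c.1 q.out,
    ⟨fun e => c.1 (tgt e) - c.1 (src e), isTension_sub src tgt c.1,
      fun e => sub_ne_zero.mpr (c.2 e).symm⟩)) ⟨?_, ?_⟩
  · rintro ⟨c, hc⟩ ⟨d, hd⟩ h
    simp only [Prod.mk.injEq, Subtype.mk.injEq] at h
    obtain ⟨h₁, h₂⟩ := h
    refine Subtype.ext (funext fun v => ?_)
    have h₃ := eq_of_component_eq (src := src) (tgt := tgt) (p := fun v => c v - d v)
      (fun e => by linear_combination -congrFun h₂ e)
      (u := v) (v := (component src tgt v).out) (Quot.out_eq (component src tgt v)).symm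
    have h₄ := congrFun h₁ (component src tgt v)
    linear_combination h₃ + h₄
  · rintro ⟨g, t, ht, hnz⟩
    obtain ⟨p, hp⟩ := ht.exists_potential
    have hdiff (e : E) :
        (g (component src tgt (tgt e)) + p (tgt e) - p (component src tgt (tgt e)).out) -
          (g (component src tgt (src e)) + p (src e) - p (component src tgt (src e)).out) =
          t e := by
      rw [component_src, hp]
      ring
    refine ⟨⟨fun v => g (component src tgt v) + p v - p (component src tgt v).out,
      fun e he => hnz e ?_⟩, ?_⟩
    · exact (hdiff e).symm.trans (sub_eq_zero.mpr he.symm)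
    · refine Prod.ext (funext fun q => ?_) (Subtype.ext (funext hdiff))
      have hq : component src tgt q.out = q := Quot.out_eq q
      simp [hq]

/-- The number of proper `ℓ`-colorings equals `ℓ^{c(G)}` times the number of
nowhere-zero `ZMod ℓ`-tensions: `χ_G(ℓ) = ℓ^{c(G)} · τ̄_G(ℓ)`. -/
theorem chromatic_eq_comp_pow_mul_tension {V E : Type} [Fintype V] [Fintype E]
    (src tgt : E → V) (l : ℕ) (hl : 0 < l) :
    Nat.card {c : V → Fin l // ∀ e : E, c (src e) ≠ c (tgt e)} =
      l ^ (ncomp src tgt) * nzTensionCount src tgt l := by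
  have : NeZero l := ⟨hl.ne'⟩
  let f : Fin l ≃ ZMod l := (ZMod.finEquiv l).toEquiv
  rw [Nat.card_congr ((Equiv.subtypeEquiv (Equiv.arrowCongr (Equiv.refl V) f)
      (fun c => by simp)).trans (coloringEquiv src tgt l)),
    Nat.card_prod, Nat.card_fun, Nat.card_zmod]
  rfl

end ModularFlows
end

section
/- Let G = (V,E) be an oriented graph, ℓ a positive integer, c : V → {0,…,ℓ−1} an ℓ-coloring, and let t : E → Z/ℓZ be the induced Z_ℓ-tension given by t(e) = c(s(e)) − c(t(e)) mod ℓ on each edge e from s(e) to t(e). Then the map σ ↦ σ ∩ (E \ supp(t)) is a bijection between the acyclic reorientations σ of G that are compatible with c and the acyclic reorientations of G_∖supp(t). -/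
namespace ModularFlows

attribute [local instance] Classical.propDecidable

variable {V E : Type}

lemma rsrc_dsrc (src tgt : E → V) (S : Set E) {σ τ : Set E} (e : {e : E // e ∉ S})
    (h : e.1 ∈ σ ↔ e.1 ∈ τ) :
    rsrc (dsrc src S) (dsrc tgt S) {e | e.1 ∈ σ} e = rsrc src tgt τ e.1 := by
  simp [rsrc, dsrc, h]

lemma rtgt_dsrc (src tgt : E → V) (S : Set E) {σ τ : Set E} (e : {e : E // e ∉ S})
    (h : e.1 ∈ σ ↔ e.1 ∈ τ) :
    rtgt (dsrc src S) (dsrc tgt S) {e | e.1 ∈ σ} e = rtgt src tgt τ e.1 := by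
  simp [rtgt, dsrc, h]

/-- Directed cycles of a reoriented deletion are the directed cycles of the reoriented graph
that avoid the deleted edges. -/
lemma isDirCycle_deletion_iff (src tgt : E → V) (S : Set E) {σ τ : Set E}
    (h : ∀ e ∉ S, (e ∈ σ ↔ e ∈ τ)) (n : ℕ) (p : Fin (n + 1) → {e : E // e ∉ S}) :
    IsDirCycle (rsrc (dsrc src S) (dsrc tgt S) {e | e.1 ∈ σ})
      (rtgt (dsrc src S) (dsrc tgt S) {e | e.1 ∈ σ}) n p ↔
    IsDirCycle (rsrc src tgt τ) (rtgt src tgt τ) n (fun i => (p i).1) := by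
  have hs e := rsrc_dsrc src tgt S e (h e.1 e.2)
  have ht e := rtgt_dsrc src tgt S e (h e.1 e.2)
  simp only [IsDirCycle, hs, ht]

/-- A potential that weakly increases along every edge is constant along directed cycles. -/
lemma IsDirCycle.potential_eq {src tgt : E → V} {n : ℕ} {p : Fin (n + 1) → E}
    (hp : IsDirCycle src tgt n p) (f : V → ℕ) (hf : ∀ e, f (src e) ≤ f (tgt e))
    (i : Fin (n + 1)) : f (src (p i)) = f (tgt (p i)) := by
  have hsum : ∑ i, f (src (p i)) = ∑ i, f (tgt (p i)) := by
    simp only [hp.2]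
    exact (Equiv.sum_comp (Equiv.addRight 1) fun i => f (src (p i))).symm
  exact (Finset.sum_eq_sum_iff_of_le fun i _ => hf (p i)).1 hsum i (Finset.mem_univ i)

lemma natCast_sub_natCast_fin_eq_zero_iff {l : ℕ} (a b : Fin l) :
    ((a : ℕ) : ZMod l) - ((b : ℕ) : ZMod l) = 0 ↔ a = b := by
  rw [sub_eq_zero, ZMod.natCast_eq_natCast_iff', Nat.mod_eq_of_lt a.2, Nat.mod_eq_of_lt b.2,
    Fin.ext_iff]

/-- A compatible reorientation reverses a bichromatic edge exactly when its source has the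
larger color. -/
lemma mem_iff_lt_of_compatible {α : Type*} [LinearOrder α] {src tgt : E → V} {σ : Set E}
    {c : V → α} {e : E} (h : c (rsrc src tgt σ e) ≤ c (rtgt src tgt σ e))
    (hne : c (src e) ≠ c (tgt e)) : e ∈ σ ↔ c (tgt e) < c (src e) := by
  by_cases he : e ∈ σ
  · simp only [rsrc, rtgt, he, if_true] at h
    simp [he, lt_of_le_of_ne h hne.symm]
  · simp only [rsrc, rtgt, he, if_false] at h
    simp [he, h]

/-- For an `ℓ`-coloring `c` with induced tension `t(e) = c(src e) - c(tgt e)`,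
the map `σ ↦ σ ∩ (E ∖ supp t)` is a bijection between the acyclic
reorientations of `G` compatible with `c` and the acyclic reorientations of
the deletion `G∖supp t`. -/
theorem compatible_acyclic_bijection {V E : Type} [Fintype V] [Fintype E]
    (src tgt : E → V) (l : ℕ) (hl : 0 < l)
    (c : V → Fin l) (t : E → ZMod l)
    (ht : ∀ e : E, t e = ((c (src e) : ℕ) : ZMod l) - ((c (tgt e) : ℕ) : ZMod l)) :
    Set.BijOn (fun σ : Set E => σ ∩ {e | t e = 0})
      {σ : Set E | Acyclic (rsrc src tgt σ) (rtgt src tgt σ) ∧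
        ∀ e : E, c (rsrc src tgt σ e) ≤ c (rtgt src tgt σ e)}
      {σ : Set E | σ ⊆ {e | t e = 0} ∧
        AcyclicReorDel src tgt {e | t e ≠ 0} σ} := by
  have hzero (e : E) : t e = 0 ↔ c (src e) = c (tgt e) := by
    rw [ht, natCast_sub_natCast_fin_eq_zero_iff]
  refine ⟨?_, ?_, ?_⟩
  · rintro σ ⟨hac, -⟩
    refine ⟨Set.inter_subset_right, fun n p hp => hac n (fun i => (p i).1) ?_⟩
    refine (isDirCycle_deletion_iff src tgt _ (fun e he => ?_) n p).1 hp
    simp only [Set.mem_ofPred_eq, not_not] at he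
    simp [he]
  · rintro σ ⟨-, hσ⟩ τ ⟨-, hτ⟩ hστ
    ext e
    by_cases he : t e = 0
    · simpa [he] using Set.ext_iff.1 hστ e
    · rw [mem_iff_lt_of_compatible (hσ e) (mt (hzero e).2 he),
        mem_iff_lt_of_compatible (hτ e) (mt (hzero e).2 he)]
  · rintro τ ⟨hsub, hac⟩
    have hmem (e : E) (he : t e = 0) :
        e ∈ τ ∪ {e | c (tgt e) < c (src e)} ↔ e ∈ τ := by
      simp [(hzero e).1 he]
    have hcompat (e : E) : c (rsrc src tgt (τ ∪ {e | c (tgt e) < c (src e)}) e) ≤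
        c (rtgt src tgt (τ ∪ {e | c (tgt e) < c (src e)}) e) := by
      by_cases he : e ∈ τ ∪ {e | c (tgt e) < c (src e)}
      · simp only [rsrc, rtgt, he, if_true]
        exact he.elim (fun h => ((hzero e).1 (hsub h)).ge) fun h => le_of_lt h
      · simp only [rsrc, rtgt, he, if_false]
        exact not_lt.1 fun h => he (Or.inr h)
    refine ⟨τ ∪ {e | c (tgt e) < c (src e)}, ⟨fun n p hp => ?_, hcompat⟩, ?_⟩
    · have hp0 (i : Fin (n + 1)) : t (p i) = 0 := by
        have h := hp.potential_eq (fun v => (c v : ℕ)) hcompat i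
        rw [hzero]
        by_cases he : p i ∈ τ ∪ {e | c (tgt e) < c (src e)}
        · simpa only [rsrc, rtgt, he, if_true, Fin.val_inj, eq_comm] using h
        · simpa only [rsrc, rtgt, he, if_false, Fin.val_inj] using h
      refine hac n (fun i => ⟨p i, not_not.2 (hp0 i)⟩) ?_
      exact (isDirCycle_deletion_iff src tgt _ (fun e he => (hmem e (not_not.1 he)).symm) n _).2 hp
    · ext e
      constructor
      · rintro ⟨he, he0⟩
        exact (hmem e he0).1 he
      · exact fun he => ⟨Or.inl he, hsub he⟩

end ModularFlows
end

section
/- Let G = (V,E) be an oriented graph. Then there is a unique subset S ⊆ E such that the restriction G[S] is totally cyclic and the contraction G_/S is acyclic. -/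
namespace ModularFlows

attribute [local instance] Classical.propDecidable

variable {V E : Type}

/-- There is an edge from `u` to `v`. -/
def Step (src tgt : E → V) (u v : V) : Prop := ∃ e, src e = u ∧ tgt e = v

/-- The edges `f 0, …, f n` form a directed walk. -/
def IsDirWalk (src tgt : E → V) (n : ℕ) (f : ℕ → E) : Prop :=
  ∀ k < n, tgt (f k) = src (f (k + 1))

theorem exists_isDirWalk {src tgt : E → V} {a b : V}
    (h : Relation.ReflTransGen (Step src tgt) a b) (e : E) (he : tgt e = a) :
    ∃ (n : ℕ) (f : ℕ → E), f 0 = e ∧ IsDirWalk src tgt n f ∧ tgt (f n) = b := by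
  induction h using Relation.ReflTransGen.head_induction_on generalizing e with
  | refl => exact ⟨0, fun _ => e, rfl, fun k hk => absurd hk k.not_lt_zero, he⟩
  | head hac _ ih =>
    obtain ⟨g, hg, hgc⟩ := hac
    obtain ⟨n, f, hf0, hf, hfn⟩ := ih g hgc
    refine ⟨n + 1, fun k => Nat.casesOn k e f, rfl, ?_, hfn⟩
    rintro (_ | k) hk
    · simp [hf0, he, hg]
    · exact hf k (by omega)

/-- A closed directed walk with a repeated vertex can be shortened without losing its first
edge. -/
theorem exists_shorter_closed_walk {src tgt : E → V} {n : ℕ} {f : ℕ → E}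
    (hf : IsDirWalk src tgt n f) (hn : tgt (f n) = src (f 0)) {i j : ℕ} (hij : i < j)
    (hj : j ≤ n) (h : src (f i) = src (f j)) :
    ∃ m < n, ∃ g : ℕ → E, g 0 = f 0 ∧ IsDirWalk src tgt m g ∧ tgt (g m) = src (f 0) := by
  rcases Nat.eq_zero_or_pos i with rfl | hi
  · refine ⟨j - 1, by omega, f, rfl, fun k hk => hf k (by omega), ?_⟩
    rw [hf (j - 1) (by omega), h, Nat.sub_add_cancel hij]
  · refine ⟨n - (j - i), by omega, fun k => if k < i then f k else f (k + (j - i)),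
      by simp [hi], fun k hk => ?_, ?_⟩
    · rcases lt_trichotomy (k + 1) i with hk' | hk' | hk'
      · simpa [hk', show k < i by omega] using hf k (by omega)
      · have h1 : i + (j - i) = j := by omega
        have := hf k (by omega)
        simp [hk', show k < i by omega, h1, this, h]
      · have h1 : k + 1 + (j - i) = k + (j - i) + 1 := by omega
        simpa [show ¬ k < i by omega, show ¬ k + 1 < i by omega, h1] using
          hf (k + (j - i)) (by omega)
    · have h1 : n - (j - i) + (j - i) = n := by omega
      simpa [show ¬ n - (j - i) < i by omega, h1] using hn

open Fin.CommRing in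
/-- An edge lies on a directed cycle iff its source is reachable from its target. -/
theorem exists_isDirCycle_iff (src tgt : E → V) (e : E) :
    (∃ (n : ℕ) (c : Fin (n + 1) → E), IsDirCycle src tgt n c ∧ e ∈ Set.range c) ↔
      Relation.ReflTransGen (Step src tgt) (tgt e) (src e) := by
  constructor
  · rintro ⟨n, c, ⟨-, hc⟩, i, rfl⟩
    have key : ∀ m : ℕ, Relation.ReflTransGen (Step src tgt) (tgt (c i))
        (src (c (i + 1 + (m : Fin (n + 1))))) := by
      intro m
      induction m with
      | zero => simp [hc, Relation.ReflTransGen.refl]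
      | succ m ih =>
        refine ih.tail ⟨_, rfl, ?_⟩
        rw [hc, Nat.cast_succ, add_assoc (i + 1)]
    have hi : i + 1 + ((n : ℕ) : Fin (n + 1)) = i := by
      rw [add_assoc, add_comm 1, ← Nat.cast_succ, Fin.natCast_self, add_zero]
    simpa only [hi] using key n
  · intro h
    have hex : ∃ n, ∃ f : ℕ → E,
        f 0 = e ∧ IsDirWalk src tgt n f ∧ tgt (f n) = src e := exists_isDirWalk h e rfl
    obtain ⟨f, hf0, hf, hfn⟩ := Nat.find_spec hex
    have hmin := fun m => Nat.find_min (H := hex) (m := m)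
    generalize Nat.find hex = n at hf hfn hmin
    subst hf0
    have hne : ∀ i j : ℕ, i < j → j ≤ n → src (f i) ≠ src (f j) := by
      intro i j hij hj hs
      obtain ⟨m, hm, hg⟩ := exists_shorter_closed_walk hf hfn hij hj hs
      exact hmin m hm hg
    refine ⟨n, fun i => f i, ⟨fun i j hij => ?_, fun i => ?_⟩, 0, rfl⟩
    · rcases lt_trichotomy i j with hlt | heq | hlt
      · exact absurd hij (hne i j hlt (by omega))
      · exact heq
      · exact absurd hij.symm (hne j i hlt (by omega))
    · rcases Fin.eq_castSucc_or_eq_last i with ⟨k, rfl⟩ | rfl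
      · simpa using hf k k.2
      · simpa using hfn

theorem totallyCyclic_iff (src tgt : E → V) :
    TotallyCyclic src tgt ↔ ∀ e, Relation.ReflTransGen (Step src tgt) (tgt e) (src e) :=
  forall_congr' fun e => exists_isDirCycle_iff src tgt e

theorem acyclic_iff (src tgt : E → V) :
    Acyclic src tgt ↔ ∀ e, ¬ Relation.ReflTransGen (Step src tgt) (tgt e) (src e) := by
  simp only [← exists_isDirCycle_iff]
  exact ⟨fun h e ⟨n, c, hc, _⟩ => h n c hc, fun h n c hc => h (c 0) ⟨n, c, hc, 0, rfl⟩⟩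

/-- The set of edges lying on a directed cycle. -/
def cyclicEdges (src tgt : E → V) : Set E :=
  {e | Relation.ReflTransGen (Step src tgt) (tgt e) (src e)}

theorem reachable_cyclicEdges {src tgt : E → V} {a b : V}
    (hab : Relation.ReflTransGen (Step src tgt) a b)
    (hba : Relation.ReflTransGen (Step src tgt) b a) :
    Relation.ReflTransGen (Step (ressrc src (cyclicEdges src tgt))
      (ressrc tgt (cyclicEdges src tgt))) a b := by
  induction hab with
  | refl => exact .refl
  | tail hac hcd ih =>
    refine (ih (.head hcd hba)).tail ?_
    obtain ⟨f, rfl, rfl⟩ := hcd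
    exact ⟨⟨f, hba.trans hac⟩, rfl, rfl⟩

theorem totallyCyclic_restrict_cyclicEdges (src tgt : E → V) :
    TotallyCyclic (ressrc src (cyclicEdges src tgt)) (ressrc tgt (cyclicEdges src tgt)) :=
  (totallyCyclic_iff _ _).2 fun e => reachable_cyclicEdges e.2 (.single ⟨e.1, rfl, rfl⟩)

theorem reachable_of_mk_eq {src tgt : E → V} {a b : V}
    (h : Quot.mk (linkRel src tgt (cyclicEdges src tgt)) a = Quot.mk _ b) :
    Relation.ReflTransGen (Step src tgt) a b := by
  suffices Relation.ReflTransGen (Step src tgt) a b ∧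
      Relation.ReflTransGen (Step src tgt) b a from this.1
  induction Quot.eqvGen_exact h with
  | rel x y hxy =>
    obtain ⟨e, he, rfl, rfl⟩ := hxy
    exact ⟨.single ⟨e, rfl, rfl⟩, he⟩
  | refl x => exact ⟨.refl, .refl⟩
  | symm x y hxy ih => exact (ih (Quot.eqvGen_sound hxy)).symm
  | trans x y z hxy hyz ih₁ ih₂ =>
    have h₁ := ih₁ (Quot.eqvGen_sound hxy)
    have h₂ := ih₂ (Quot.eqvGen_sound hyz)
    exact ⟨h₁.1.trans h₂.1, h₂.2.trans h₁.2⟩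

theorem acyclic_contract_cyclicEdges (src tgt : E → V) :
    Acyclic (csrc src tgt (cyclicEdges src tgt)) (ctgt src tgt (cyclicEdges src tgt)) := by
  have lift : ∀ {x y}, Relation.ReflTransGen (Step (csrc src tgt (cyclicEdges src tgt))
      (ctgt src tgt (cyclicEdges src tgt))) x y → ∀ a b, Quot.mk _ a = x → Quot.mk _ b = y →
      Relation.ReflTransGen (Step src tgt) a b := by
    intro x y h
    induction h with
    | refl => exact fun a b ha hb => reachable_of_mk_eq (ha.trans hb.symm)
    | tail _ hcd ih =>
      obtain ⟨f, hf, hf'⟩ := hcd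
      exact fun a b ha hb => ((ih a (src f.1) ha hf).tail ⟨f.1, rfl, rfl⟩).trans
        (reachable_of_mk_eq (hf'.trans hb.symm))
  exact (acyclic_iff _ _).2 fun e h => e.2 (lift h _ _ rfl rfl)

theorem subset_cyclicEdges {src tgt : E → V} {S : Set E}
    (h : TotallyCyclic (ressrc src S) (ressrc tgt S)) : S ⊆ cyclicEdges src tgt := fun e he =>
  Relation.ReflTransGen.mono (fun _ _ ⟨f, hf⟩ => ⟨f.1, hf⟩) _ _ ((totallyCyclic_iff _ _).1 h ⟨e, he⟩)

theorem cyclicEdges_subset {src tgt : E → V} {S : Set E}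
    (h : Acyclic (csrc src tgt S) (ctgt src tgt S)) : cyclicEdges src tgt ⊆ S := by
  intro e he
  by_contra heS
  refine (acyclic_iff _ _).1 h ⟨e, heS⟩ ?_
  refine Relation.ReflTransGen.lift' (Quot.mk (linkRel src tgt S)) ?_ _ _ he
  rintro _ _ ⟨f, rfl, rfl⟩
  by_cases hf : f ∈ S
  · change Relation.ReflTransGen _ _ _
    rw [Quot.sound (r := linkRel src tgt S) ⟨f, hf, rfl, rfl⟩]
  · exact .single ⟨⟨f, hf⟩, rfl, rfl⟩

/-- There is a unique edge set `S` such that the restriction `G[S]` is totally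
cyclic and the contraction `G/S` is acyclic. -/
theorem unique_totally_cyclic_acyclic_split {V E : Type} [Fintype V] [Fintype E]
    (src tgt : E → V) :
    ∃! S : Set E,
      TotallyCyclic (ressrc src S) (ressrc tgt S) ∧
      Acyclic (csrc src tgt S) (ctgt src tgt S) :=
  ⟨cyclicEdges src tgt,
    ⟨totallyCyclic_restrict_cyclicEdges src tgt, acyclic_contract_cyclicEdges src tgt⟩,
    fun _ hS => (subset_cyclicEdges hS.1).antisymm (cyclicEdges_subset hS.2)⟩

end ModularFlows
end
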